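/- Let α, ν, β > 0, κ ∈ (0,1) with κ(α/ν − 1) < 1 and ν/κ + (ν − α) > 1, and let f be the κGG density with mean m. For every real θ with θ ≠ 0, θ ≠ 1 and −α < θ < ν/κ + (ν − α), the generalized entropy measure GE(θ) = (1/(θ² − θ))·∫₀^∞ [ (x/m)^θ − 1 ] f(x) dx equals (1/(θ² − θ))·{ (β/m)^θ · [ (2κ)^{−θ/ν} · (ν + κ(α−ν))/(ν + κ(θ+α−ν)) · Γ(1/(2κ) − (θ+α−ν)/(2ν))/Γ(1/(2κ) + (θ+α−ν)/(2ν)) · Γ(1/(2κ) + (α−ν)/(2ν))/Γ(1/(2κ) − (α−ν)/(2ν)) · Γ((θ+α)/ν)/Γ(α/ν) ] − 1 }. -/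

import Mathlib

open Real MeasureTheory Filter Set

/-- The κ-deformed exponential of Kaniadakis. -/
noncomputable def kexp (κ x : ℝ) : ℝ := (Real.sqrt (1 + κ^2 * x^2) + κ * x) ^ (1/κ)

/-- The κ-deformed logarithm of Kaniadakis. -/
noncomputable def klog (κ x : ℝ) : ℝ := (x ^ κ - x ^ (-κ)) / (2*κ)

/-- The κ-deformed Gamma function (closed form in terms of the Euler Gamma function). -/
noncomputable def kGamma (κ z : ℝ) : ℝ :=
  ((1 - κ*(z-1)) / (2*κ) ^ (z-1)) *
    (Real.Gamma (1/(2*κ) - (z-1)/2) / Real.Gamma (1/(2*κ) + (z-1)/2)) * Real.Gamma z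

/-- The κ-Generalized Gamma (κGG) density. -/
noncomputable def kGG (α ν β κ x : ℝ) : ℝ :=
  (1 - κ^2*(α/ν - 1)^2) * (ν/β) * (kGamma κ (α/ν))⁻¹ * (x/β) ^ (α-1) *
    kexp κ (-((x/β) ^ ν)) / Real.sqrt (1 + κ^2 * (x/β) ^ (2*ν))

open ProbabilityTheory (beta beta_eq_betaIntegralReal)

lemma integrableOn_rpow_mul_one_sub_rpow {a b : ℝ} (ha : 0 < a) (hb : 0 < b) :
    IntegrableOn (fun x : ℝ => x ^ (a - 1) * (1 - x) ^ (b - 1)) (Ioo 0 1) := by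
  have hc := Complex.betaIntegral_convergent (u := a) (v := b) (by simpa) (by simpa)
  rw [intervalIntegrable_iff_integrableOn_Ioo_of_le zero_le_one] at hc
  refine hc.re.congr ?_
  filter_upwards [ae_restrict_mem measurableSet_Ioo] with x hx
  norm_cast
  rw [← Complex.ofReal_cpow hx.1.le, ← Complex.ofReal_cpow (sub_nonneg.2 hx.2.le),
    ← Complex.ofReal_mul]
  simp

lemma integral_rpow_mul_one_sub_rpow {a b : ℝ} (ha : 0 < a) (hb : 0 < b) :
    ∫ x in Ioo (0 : ℝ) 1, x ^ (a - 1) * (1 - x) ^ (b - 1) = beta a b := by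
  have hc := Complex.betaIntegral_convergent (u := a) (v := b) (by simpa) (by simpa)
  rw [intervalIntegrable_iff_integrableOn_Ioo_of_le zero_le_one] at hc
  rw [beta_eq_betaIntegralReal a b ha hb, Complex.betaIntegral,
    intervalIntegral.integral_of_le zero_le_one, integral_Ioc_eq_integral_Ioo,
    ← RCLike.re_to_complex, ← integral_re hc]
  refine setIntegral_congr_fun measurableSet_Ioo fun x hx => ?_
  norm_cast
  rw [← Complex.ofReal_cpow hx.1.le, ← Complex.ofReal_cpow (sub_nonneg.2 hx.2.le),
    ← Complex.ofReal_mul]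
  simp

/-- The substitution `w ↦ (w^(-1/2) - w^(1/2)) / (2κ)`, mapping `(0, 1)` onto `(0, ∞)`. -/
noncomputable def ksub (κ w : ℝ) : ℝ := ((√w)⁻¹ - √w) / (2 * κ)

lemma sqrt_one_add_sq_mul_ksub_sq {κ w : ℝ} (hκ : 0 < κ) (hw : 0 < w) :
    √(1 + κ ^ 2 * ksub κ w ^ 2) = ((√w)⁻¹ + √w) / 2 := by
  have hr : 0 < √w := sqrt_pos.2 hw
  rw [show 1 + κ ^ 2 * ksub κ w ^ 2 = (((√w)⁻¹ + √w) / 2) ^ 2 by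
    unfold ksub; field_simp; ring]
  exact sqrt_sq (by positivity)

lemma sqrt_sub_mul_ksub {κ w : ℝ} (hκ : 0 < κ) (hw : 0 < w) :
    √(1 + κ ^ 2 * ksub κ w ^ 2) - κ * ksub κ w = √w := by
  rw [sqrt_one_add_sq_mul_ksub_sq hκ hw, ksub]
  field_simp
  ring

lemma ksub_injOn {κ : ℝ} (hκ : 0 < κ) : InjOn (ksub κ) (Ioo 0 1) := by
  intro x hx y hy hxy
  have h := sqrt_sub_mul_ksub hκ hx.1
  rw [hxy, sqrt_sub_mul_ksub hκ hy.1] at h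
  exact ((sqrt_inj hy.1.le hx.1.le).1 h).symm

lemma ksub_image_Ioo {κ : ℝ} (hκ : 0 < κ) : ksub κ '' Ioo 0 1 = Ioi 0 := by
  ext t
  constructor
  · rintro ⟨w, hw, rfl⟩
    have hr : 0 < √w := sqrt_pos.2 hw.1
    have hr1 : √w < 1 := by rw [sqrt_lt' one_pos]; simpa using hw.2
    have := (one_lt_inv₀ hr).2 hr1
    exact div_pos (sub_pos.2 (hr1.trans this)) (mul_pos two_pos hκ)
  · intro ht
    have ht : 0 < κ * t := mul_pos hκ ht
    set s := √(1 + κ ^ 2 * t ^ 2) with hs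
    have hs2 : s ^ 2 = 1 + κ ^ 2 * t ^ 2 := sq_sqrt (by positivity)
    have hs0 : 0 ≤ s := sqrt_nonneg _
    have hlt : κ * t < s := by nlinarith
    have hs1 : s - κ * t < 1 := by nlinarith
    have hpos : 0 < s - κ * t := sub_pos.2 hlt
    refine ⟨(s - κ * t) ^ 2, ⟨by positivity, by nlinarith⟩, ?_⟩
    have hinv : (s - κ * t)⁻¹ = s + κ * t := inv_eq_of_mul_eq_one_right (by linear_combination hs2)
    rw [ksub, sqrt_sq hpos.le, hinv]
    field_simp
    ring

lemma hasDerivAt_ksub {κ w : ℝ} (hw : 0 < w) :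
    HasDerivAt (ksub κ) (-(((√w)⁻¹ + √w) / 2 * w⁻¹ / (2 * κ))) w := by
  have hr : 0 < √w := sqrt_pos.2 hw
  have h := hasDerivAt_sqrt hw.ne'
  refine (((h.inv hr.ne').sub h).div_const (2 * κ)).congr_deriv ?_
  have hw2 : w⁻¹ = (√w ^ 2)⁻¹ := by rw [sq_sqrt hw.le]
  rw [hw2]
  field_simp
  ring

/-- The κ-deformed analogue of the integrand of Euler's Gamma integral. -/
noncomputable def kGammaIntegrand (κ z t : ℝ) : ℝ :=
  t ^ (z - 1) * kexp κ (-t) / √(1 + κ ^ 2 * t ^ 2)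

lemma kGammaIntegrand_ksub {κ z w : ℝ} (hκ : 0 < κ) (hw : w ∈ Ioo (0 : ℝ) 1) :
    |-(((√w)⁻¹ + √w) / 2 * w⁻¹ / (2 * κ))| • kGammaIntegrand κ z (ksub κ w) =
      (2 * κ) ^ (-z) * (w ^ (1 / (2 * κ) - (z - 1) / 2 - 1) * (1 - w) ^ (z - 1)) := by
  have hw0 := hw.1
  have hr : 0 < √w := sqrt_pos.2 hw0
  have hexp : kexp κ (-ksub κ w) = w ^ (1 / (2 * κ)) := by
    rw [kexp, neg_sq, mul_neg, ← sub_eq_add_neg, sqrt_sub_mul_ksub hκ hw0, sqrt_eq_rpow,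
      ← rpow_mul hw0.le]
    congr 1
    field_simp
  have hk : ksub κ w = w ^ (-(1 / 2) : ℝ) * (1 - w) * (2 * κ)⁻¹ := by
    rw [rpow_neg hw0.le, ← sqrt_eq_rpow, ksub]
    have := sq_sqrt hw0.le
    field_simp
    rw [this]
  have h1 : (2 * κ) ^ (-z) = (2 * κ)⁻¹ * (2 * κ)⁻¹ ^ (z - 1) := by
    rw [inv_rpow (by positivity), ← rpow_neg (by positivity), ← rpow_neg_one,
      ← rpow_add (by positivity)]
    congr 1
    ring
  have h2 : w ^ (1 / (2 * κ) - (z - 1) / 2 - 1) =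
      w ^ (1 / (2 * κ)) * w ^ (-(1 / 2) * (z - 1)) * w⁻¹ := by
    rw [← rpow_neg_one, ← rpow_add hw0, ← rpow_add hw0]
    congr 1
    ring
  rw [abs_neg, abs_of_pos (by positivity), kGammaIntegrand, sqrt_one_add_sq_mul_ksub_sq hκ hw0,
    hexp, hk, mul_rpow (mul_nonneg (by positivity) (sub_nonneg.2 hw.2.le)) (by positivity),
    mul_rpow (by positivity) (sub_nonneg.2 hw.2.le), ← rpow_mul hw0.le, h1, h2, smul_eq_mul]
  field_simp

lemma integrableOn_kGammaIntegrand {κ z : ℝ} (hκ : 0 < κ) (hz : 0 < z) (hz' : κ * (z - 1) < 1) :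
    IntegrableOn (kGammaIntegrand κ z) (Ioi 0) := by
  have ha : 0 < 1 / (2 * κ) - (z - 1) / 2 := by
    rw [show 1 / (2 * κ) - (z - 1) / 2 = (1 - κ * (z - 1)) / (2 * κ) by field_simp]
    exact div_pos (by linarith) (by positivity)
  rw [← ksub_image_Ioo hκ, integrableOn_image_iff_integrableOn_abs_deriv_smul measurableSet_Ioo
    (fun w hw => (hasDerivAt_ksub hw.1).hasDerivWithinAt) (ksub_injOn hκ),
    integrableOn_congr_fun (fun w hw => kGammaIntegrand_ksub hκ hw) measurableSet_Ioo]
  exact (integrableOn_rpow_mul_one_sub_rpow ha hz).const_mul _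

lemma one_add_mul_sub_one_pos {κ z : ℝ} (hκ : κ ∈ Ioo (0 : ℝ) 1) (hz : 0 < z) :
    0 < 1 + κ * (z - 1) := by
  nlinarith [hκ.1, hκ.2, mul_pos hκ.1 hz]

lemma integral_kGammaIntegrand {κ z : ℝ} (hκ : κ ∈ Ioo (0 : ℝ) 1) (hz : 0 < z)
    (hz' : κ * (z - 1) < 1) :
    ∫ t in Ioi 0, kGammaIntegrand κ z t = kGamma κ z / (1 - κ ^ 2 * (z - 1) ^ 2) := by
  have hκ0 := hκ.1
  have hneg : 0 < 1 - κ * (z - 1) := by linarith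
  have hpos := one_add_mul_sub_one_pos hκ hz
  have ha : 0 < 1 / (2 * κ) - (z - 1) / 2 := by
    rw [show 1 / (2 * κ) - (z - 1) / 2 = (1 - κ * (z - 1)) / (2 * κ) by field_simp]
    positivity
  have hb : 1 / (2 * κ) + (z - 1) / 2 = (1 + κ * (z - 1)) / (2 * κ) := by field_simp
  have hb0 : 0 < 1 / (2 * κ) + (z - 1) / 2 := by rw [hb]; positivity
  have hΓ := Gamma_pos_of_pos hb0
  have hsum : Gamma (1 / (2 * κ) - (z - 1) / 2 + z) =
      (1 + κ * (z - 1)) / (2 * κ) * Gamma (1 / (2 * κ) + (z - 1) / 2) := by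
    rw [← hb, ← Gamma_add_one hb0.ne']
    congr 1
    ring
  have hpow : (2 * κ) ^ (-z) = ((2 * κ) ^ (z - 1) * (2 * κ))⁻¹ := by
    rw [rpow_neg (by positivity), rpow_sub_one (by positivity)]
    field_simp
  have hp : 0 < (2 * κ) ^ (z - 1) := by positivity
  rw [← ksub_image_Ioo hκ0, integral_image_eq_integral_abs_deriv_smul measurableSet_Ioo
    (fun w hw => (hasDerivAt_ksub hw.1).hasDerivWithinAt) (ksub_injOn hκ0),
    setIntegral_congr_fun measurableSet_Ioo (fun w hw => kGammaIntegrand_ksub hκ0 hw),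
    integral_const_mul, integral_rpow_mul_one_sub_rpow ha hz, beta, hsum, hpow, kGamma,
    show 1 - κ ^ 2 * (z - 1) ^ 2 = (1 - κ * (z - 1)) * (1 + κ * (z - 1)) by ring]
  generalize (2 * κ) ^ (z - 1) = p at *
  generalize Gamma (1 / (2 * κ) + (z - 1) / 2) = g at *
  field_simp

lemma kGamma_pos {κ z : ℝ} (hκ : κ ∈ Ioo (0 : ℝ) 1) (hz : 0 < z) (hz' : κ * (z - 1) < 1) :
    0 < kGamma κ z := by
  have hκ0 := hκ.1
  have hneg : 0 < 1 - κ * (z - 1) := by linarith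
  have hpos := one_add_mul_sub_one_pos hκ hz
  have ha : 0 < 1 / (2 * κ) - (z - 1) / 2 := by
    rw [show 1 / (2 * κ) - (z - 1) / 2 = (1 - κ * (z - 1)) / (2 * κ) by field_simp]
    positivity
  have hb : 0 < 1 / (2 * κ) + (z - 1) / 2 := by
    rw [show 1 / (2 * κ) + (z - 1) / 2 = (1 + κ * (z - 1)) / (2 * κ) by field_simp]
    positivity
  have := Gamma_pos_of_pos ha
  have := Gamma_pos_of_pos hb
  have := Gamma_pos_of_pos hz
  rw [kGamma]
  positivity

lemma one_sub_sq_mul_sq_pos {κ z : ℝ} (hκ : κ ∈ Ioo (0 : ℝ) 1) (hz : 0 < z)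
    (hz' : κ * (z - 1) < 1) : 0 < 1 - κ ^ 2 * (z - 1) ^ 2 := by
  have := mul_pos (sub_pos.2 hz') (one_add_mul_sub_one_pos hκ hz)
  linarith

lemma kGG_nonneg {α ν β κ x : ℝ} (hα : 0 < α) (hν : 0 < ν) (hβ : 0 < β)
    (hκ : κ ∈ Ioo (0 : ℝ) 1) (h : κ * (α / ν - 1) < 1) (hx : 0 < x) : 0 ≤ kGG α ν β κ x := by
  have hz := div_pos hα hν
  have := one_sub_sq_mul_sq_pos hκ hz h
  have := kGamma_pos hκ hz h
  have hexp : 0 ≤ kexp κ (-(x / β) ^ ν) := by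
    refine rpow_nonneg ?_ _
    have := abs_le_sqrt (x := κ * (x / β) ^ ν) (y := 1 + κ ^ 2 * (-(x / β) ^ ν) ^ 2)
      (by rw [neg_sq, mul_pow]; linarith)
    linarith [le_abs_self (κ * (x / β) ^ ν)]
  rw [kGG]
  positivity

lemma rpow_mul_kGG {α ν β κ θ x : ℝ} (hν : 0 < ν) (hβ : 0 < β) (hx : 0 < x) :
    x ^ θ * kGG α ν β κ x =
      β ^ θ * ((1 - κ ^ 2 * (α / ν - 1) ^ 2) * (kGamma κ (α / ν))⁻¹) * β⁻¹ *
        ((ν * (β⁻¹ * x) ^ (ν - 1)) • kGammaIntegrand κ ((θ + α) / ν) ((β⁻¹ * x) ^ ν)) := by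
  have hy : 0 < β⁻¹ * x := by positivity
  have hxy : x / β = β⁻¹ * x := by field_simp
  have hxθ : x ^ θ = β ^ θ * (β⁻¹ * x) ^ θ := by
    rw [← mul_rpow hβ.le hy.le]
    congr 1
    field_simp
  have h2 : (β⁻¹ * x) ^ (2 * ν) = ((β⁻¹ * x) ^ ν) ^ 2 := by
    rw [mul_comm 2 ν, rpow_mul hy.le, rpow_two]
  have h3 : (β⁻¹ * x) ^ θ * (β⁻¹ * x) ^ (α - 1) =
      (β⁻¹ * x) ^ (ν - 1) * ((β⁻¹ * x) ^ ν) ^ ((θ + α) / ν - 1) := by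
    rw [← rpow_mul hy.le, ← rpow_add hy, ← rpow_add hy]
    congr 1
    field_simp
    ring
  rw [kGG, hxy, hxθ, h2, kGammaIntegrand, smul_eq_mul]
  linear_combination (β ^ θ * ((1 - κ ^ 2 * (α / ν - 1) ^ 2) * (kGamma κ (α / ν))⁻¹) * β⁻¹ * ν *
    (kexp κ (-(β⁻¹ * x) ^ ν) / √(1 + κ ^ 2 * ((β⁻¹ * x) ^ ν) ^ 2))) * h3

lemma integrableOn_rpow_mul_kGG {α ν β κ θ : ℝ} (hν : 0 < ν) (hβ : 0 < β) (hκ : 0 < κ)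
    (hz : 0 < (θ + α) / ν) (hz' : κ * ((θ + α) / ν - 1) < 1) :
    IntegrableOn (fun x => x ^ θ * kGG α ν β κ x) (Ioi 0) := by
  refine (integrableOn_congr_fun (fun x hx => rpow_mul_kGG hν hβ hx) measurableSet_Ioi).2 ?_
  refine Integrable.const_mul ?_ _
  have h1 := (integrableOn_Ioi_comp_rpow_iff _ hν.ne').2 (integrableOn_kGammaIntegrand hκ hz hz')
  rw [abs_of_pos hν] at h1
  refine (integrableOn_Ioi_comp_mul_left_iff
    (fun y => (ν * y ^ (ν - 1)) • kGammaIntegrand κ ((θ + α) / ν) (y ^ ν)) 0 (inv_pos.2 hβ)).2 ?_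
  rwa [mul_zero]

lemma integral_rpow_mul_kGG {α ν β κ θ : ℝ} (hν : 0 < ν) (hβ : 0 < β) (hκ : κ ∈ Ioo (0 : ℝ) 1)
    (hz : 0 < (θ + α) / ν) (hz' : κ * ((θ + α) / ν - 1) < 1) :
    ∫ x in Ioi 0, x ^ θ * kGG α ν β κ x =
      β ^ θ * ((1 - κ ^ 2 * (α / ν - 1) ^ 2) * (kGamma κ (α / ν))⁻¹) *
        (kGamma κ ((θ + α) / ν) / (1 - κ ^ 2 * ((θ + α) / ν - 1) ^ 2)) := by
  rw [setIntegral_congr_fun measurableSet_Ioi (fun x hx => rpow_mul_kGG hν hβ hx),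
    integral_const_mul, integral_comp_mul_left_Ioi
      (fun y => (ν * y ^ (ν - 1)) • kGammaIntegrand κ ((θ + α) / ν) (y ^ ν)) 0 (inv_pos.2 hβ),
    mul_zero, integral_comp_rpow_Ioi_of_pos hν, integral_kGammaIntegrand hκ hz hz', smul_eq_mul]
  field_simp

/-- The generalized entropy measure of the κGG distribution. -/
theorem kGG_generalized_entropy (α ν β κ m θ : ℝ) (hα : 0 < α) (hν : 0 < ν) (hβ : 0 < β)
    (hκ : κ ∈ Set.Ioo (0:ℝ) 1) (h : κ * (α/ν - 1) < 1) (hmom : 1 < ν/κ + (ν - α))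
    (hm : m = ∫ x in Set.Ioi (0:ℝ), x * kGG α ν β κ x)
    (hθ0 : θ ≠ 0) (hθ1 : θ ≠ 1) (hθl : -α < θ) (hθu : θ < ν/κ + (ν - α)) :
    (1/(θ^2 - θ)) * ∫ x in Set.Ioi (0:ℝ), ((x/m) ^ θ - 1) * kGG α ν β κ x =
      (1/(θ^2 - θ)) *
        ( (β/m) ^ θ *
          ( (2*κ) ^ (-(θ/ν)) * ((ν + κ*(α-ν)) / (ν + κ*(θ+α-ν))) *
            (Real.Gamma (1/(2*κ) - (θ+α-ν)/(2*ν)) / Real.Gamma (1/(2*κ) + (θ+α-ν)/(2*ν))) *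
            (Real.Gamma (1/(2*κ) + (α-ν)/(2*ν)) / Real.Gamma (1/(2*κ) - (α-ν)/(2*ν))) *
            (Real.Gamma ((θ+α)/ν) / Real.Gamma (α/ν)) ) - 1 ) := by
  have hκ0 := hκ.1
  have hz0 : 0 < α / ν := div_pos hα hν
  have hz : 0 < (θ + α) / ν := div_pos (by linarith) hν
  have hz' : κ * ((θ + α) / ν - 1) < 1 := by
    have h1 : θ + α - ν < ν / κ := by linarith
    rw [lt_div_iff₀ hκ0] at h1
    rw [show κ * ((θ + α) / ν - 1) = (θ + α - ν) * κ / ν by field_simp, div_lt_one hν]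
    exact h1
  have hm0 : 0 ≤ m := hm ▸ setIntegral_nonneg measurableSet_Ioi fun x hx =>
    mul_nonneg (le_of_lt hx) (kGG_nonneg hα hν hβ hκ h hx)
  have hD0 := one_sub_sq_mul_sq_pos hκ hz0 h
  have hG0 := kGamma_pos hκ hz0 h
  have hint0 : IntegrableOn (kGG α ν β κ) (Ioi 0) := by
    simpa using integrableOn_rpow_mul_kGG (α := α) (θ := 0) hν hβ hκ0 (by simpa) (by simpa)
  have hone : ∫ x in Ioi 0, kGG α ν β κ x = 1 := by
    have := integral_rpow_mul_kGG (α := α) (θ := 0) hν hβ hκ (by simpa) (by simpa)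
    simp only [rpow_zero, one_mul, zero_add] at this
    rw [this]
    generalize 1 - κ ^ 2 * (α / ν - 1) ^ 2 = d at hD0 ⊢
    field_simp
  have hsplit : ∫ x in Ioi (0 : ℝ), ((x / m) ^ θ - 1) * kGG α ν β κ x =
      (m ^ θ)⁻¹ * (∫ x in Ioi 0, x ^ θ * kGG α ν β κ x) - 1 := by
    rw [← integral_const_mul]
    conv_rhs => rw [← hone]
    rw [← integral_sub
      ((integrableOn_rpow_mul_kGG hν hβ hκ0 hz hz').const_mul _) hint0]
    refine setIntegral_congr_fun measurableSet_Ioi fun x hx => ?_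
    simp only [div_rpow (le_of_lt hx) hm0]
    ring
  rw [hsplit, integral_rpow_mul_kGG hν hβ hκ hz hz', div_rpow hβ.le hm0]
  congr 2
  rw [div_eq_mul_inv (β ^ θ), mul_comm (β ^ θ) (m ^ θ)⁻¹, mul_assoc, mul_assoc, mul_assoc]
  congr 2
  have hpos0 := one_add_mul_sub_one_pos hκ hz0
  have hpos := one_add_mul_sub_one_pos hκ hz
  have hneg0 : 0 < 1 - κ * (α / ν - 1) := by linarith
  have hneg : 0 < 1 - κ * ((θ + α) / ν - 1) := by linarith
  have e0 : (α - ν) / (2 * ν) = (α / ν - 1) / 2 := by field_simp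
  have e1 : (θ + α - ν) / (2 * ν) = ((θ + α) / ν - 1) / 2 := by field_simp
  have e2 : (ν + κ * (α - ν)) / (ν + κ * (θ + α - ν)) =
      (1 + κ * (α / ν - 1)) / (1 + κ * ((θ + α) / ν - 1)) := by
    rw [show ν + κ * (α - ν) = ν * (1 + κ * (α / ν - 1)) by field_simp,
      show ν + κ * (θ + α - ν) = ν * (1 + κ * ((θ + α) / ν - 1)) by field_simp,
      mul_div_mul_left _ _ hν.ne']
  have e3 : (2 * κ) ^ (-(θ / ν)) = (2 * κ) ^ (α / ν - 1) / (2 * κ) ^ ((θ + α) / ν - 1) := by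
    rw [← rpow_sub (by positivity)]
    congr 1
    ring
  rw [e0, e1, e2, e3]
  generalize α / ν = z₀ at *
  generalize (θ + α) / ν = z at *
  have hp0 : 0 < (2 * κ) ^ (z₀ - 1) := by positivity
  rw [kGamma, kGamma, show 1 - κ ^ 2 * (z - 1) ^ 2 = (1 - κ * (z - 1)) * (1 + κ * (z - 1)) by ring,
    show 1 - κ ^ 2 * (z₀ - 1) ^ 2 = (1 - κ * (z₀ - 1)) * (1 + κ * (z₀ - 1)) by ring]
  generalize Gamma (1 / (2 * κ) + (z - 1) / 2) = g₁
  generalize Gamma (1 / (2 * κ) - (z - 1) / 2) = g₂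
  generalize Gamma (1 / (2 * κ) + (z₀ - 1) / 2) = g₃
  generalize Gamma (1 / (2 * κ) - (z₀ - 1) / 2) = g₄
  generalize (2 * κ) ^ (z₀ - 1) = p₀ at *
  generalize (2 * κ) ^ (z - 1) = p at *
  generalize 1 - κ * (z - 1) = a at *
  generalize 1 - κ * (z₀ - 1) = a₀ at *
  field_simp
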